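/- arXiv:1102.4875 — 5 statements merged into one kernel-verified Lean document; each statement's English description precedes it below -/
import Mathlib

section
/- Let ρ : A → A be a unital *-homomorphism. Then u := ∑_{i=1}^n ρ(Sᵢ)Sᵢ* is a unitary element of A, and ρ(Sᵢ) = u Sᵢ for every i = 1,…,n. -/
noncomputable section CuntzSetup

/-- The word `S_μ = S_{μ₁} ⋯ S_{μ_k}` associated to a multi-index `μ ∈ {1,…,n}^k`. -/
def cuntzWord {A : Type*} [Monoid A] {n k : ℕ} (S : Fin n → A) (μ : Fin k → Fin n) : A :=
  (List.ofFn fun i => S (μ i)).prod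

/-- The canonical shift `φ(x) = ∑ᵢ Sᵢ x Sᵢ*`. -/
def cuntzPhi {A : Type*} [Ring A] [StarRing A] {n : ℕ} (S : Fin n → A) (x : A) : A :=
  ∑ i, S i * x * star (S i)

/-- `u_k = u φ(u) φ²(u) ⋯ φ^{k-1}(u)`. -/
def cuntzUk {A : Type*} [Ring A] [StarRing A] {n : ℕ} (S : Fin n → A) (u : A) (k : ℕ) : A :=
  ((List.range k).map fun j => (cuntzPhi S)^[j] u).prod

/-- `F_n^k`, the linear span of `{S_μ S_ν* : |μ| = |ν| = k}`. -/
def cuntzF {A : Type*} [Ring A] [StarRing A] [Algebra ℂ A] {n : ℕ} (S : Fin n → A) (k : ℕ) :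
    Submodule ℂ A :=
  Submodule.span ℂ {x | ∃ μ ν : Fin k → Fin n, x = cuntzWord S μ * star (cuntzWord S ν)}

end CuntzSetup

/-- Isometries in a C⋆-ring whose range projections sum to `1` have orthogonal ranges. -/
theorem star_mul_eq_ite_of_sum_mul_star_eq_one {A ι : Type*} [Fintype ι] [DecidableEq ι]
    [NormedRing A] [StarRing A] [CStarRing A] [PartialOrder A] [StarOrderedRing A] {S : ι → A}
    (hiso : ∀ i, star (S i) * S i = 1) (hsum : ∑ i, S i * star (S i) = 1) (i j : ι) :
    star (S i) * S j = if i = j then 1 else 0 := by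
  split_ifs with hij
  · rw [hij, hiso]
  have hconj : ∑ k, star (star (S k) * S j) * (star (S k) * S j) = 1 := by
    calc _ = star (S j) * (∑ k, S k * star (S k)) * S j := by
          simp [Finset.mul_sum, Finset.sum_mul, mul_assoc]
      _ = 1 := by rw [hsum, mul_one, hiso]
  rw [← Finset.add_sum_erase _ _ (Finset.mem_univ j), hiso, star_one, one_mul, add_eq_left,
    Finset.sum_eq_zero_iff_of_nonneg fun k _ => star_mul_self_nonneg _] at hconj
  exact CStarRing.star_mul_self_eq_zero_iff _ |>.mp
    (hconj i (Finset.mem_erase.mpr ⟨hij, Finset.mem_univ i⟩))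

/-- If the `Sᵢ` are isometries with orthogonal ranges, then `(∑ⱼ Tⱼ Sⱼ*) Sᵢ = Tᵢ`. -/
theorem sum_mul_star_mul_eq {A ι : Type*} [Fintype ι] [DecidableEq ι] [Semiring A] [StarRing A]
    {S : ι → A} (hS : ∀ i j, star (S i) * S j = if i = j then 1 else 0) (T : ι → A) (i : ι) :
    (∑ j, T j * star (S j)) * S i = T i := by
  simp [Finset.sum_mul, mul_assoc, hS]

theorem star_sum_mul_star_mul_self {A ι : Type*} [Fintype ι] [DecidableEq ι] [Semiring A]
    [StarRing A] {S T : ι → A} (hT : ∀ i j, star (T i) * T j = if i = j then 1 else 0)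
    (hsum : ∑ i, S i * star (S i) = 1) :
    star (∑ i, T i * star (S i)) * ∑ i, T i * star (S i) = 1 := by
  have hstar : star (∑ i, T i * star (S i)) = ∑ i, S i * star (T i) := by simp [star_sum]
  rw [hstar, Finset.mul_sum, ← hsum]
  exact Finset.sum_congr rfl fun i _ => by rw [← mul_assoc, sum_mul_star_mul_eq hT]

theorem sum_mul_star_mem_unitary {A ι : Type*} [Fintype ι] [DecidableEq ι] [Semiring A]
    [StarRing A] {S T : ι → A} (hS : ∀ i j, star (S i) * S j = if i = j then 1 else 0)
    (hT : ∀ i j, star (T i) * T j = if i = j then 1 else 0)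
    (hsumS : ∑ i, S i * star (S i) = 1) (hsumT : ∑ i, T i * star (T i) = 1) :
    ∑ i, T i * star (S i) ∈ unitary A := by
  refine Unitary.mem_iff.mpr ⟨star_sum_mul_star_mul_self hT hsumS, ?_⟩
  simpa [star_sum] using star_sum_mul_star_mul_self hS hsumT

/-- For a unital *-homomorphism `ρ : A → A`, the element
`u = ∑ᵢ ρ(Sᵢ)Sᵢ*` is a unitary and `ρ(Sᵢ) = u Sᵢ` for every `i`. -/
theorem stmt0 {A : Type*} [NormedRing A] [StarRing A] [CStarRing A]
    [CompleteSpace A] [NormedAlgebra ℂ A] [StarModule ℂ A]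
    {n : ℕ} (hn : 2 ≤ n) (S : Fin n → A)
    (hiso : ∀ i, star (S i) * S i = 1)
    (hcuntz : ∑ i, S i * star (S i) = 1)
    (ρ : A →⋆ₐ[ℂ] A) :
    (∑ i, ρ (S i) * star (S i)) ∈ unitary A ∧
      ∀ i, ρ (S i) = (∑ j, ρ (S j) * star (S j)) * S i := by
  let _ : CStarAlgebra A := {}
  let _ : PartialOrder A := CStarAlgebra.spectralOrder A
  have : StarOrderedRing A := CStarAlgebra.spectralOrderedRing A
  have hS := star_mul_eq_ite_of_sum_mul_star_eq_one hiso hcuntz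
  have hρ : ∀ i j, star (ρ (S i)) * ρ (S j) = if i = j then 1 else 0 := fun i j => by
    rw [← map_star, ← map_mul, hS, apply_ite ρ, map_one, map_zero]
  have hρsum : ∑ i, ρ (S i) * star (ρ (S i)) = 1 := by
    simpa [map_star] using congrArg ρ hcuntz
  exact ⟨sum_mul_star_mem_unitary hS hρ hcuntz hρsum,
    fun i => (sum_mul_star_mul_eq hS (fun j => ρ (S j)) i).symm⟩
end

section
/- Let u be a unitary in A, let λ_u : A → A be a unital *-homomorphism with λ_u(Sᵢ) = uSᵢ for all i, and assume A is generated by S₁,…,Sₙ. Then for x ∈ A the following are equivalent: (i) x commutes with λ_u(a) for every a ∈ A; (ii) x = uφ(x)u*. (This is the characterization (λ_u, λ_u) = { x ∈ A : x = (Ad u ∘ φ)(x) } of the relative commutant λ_u(A)′ ∩ A.) -/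
/-- In a C⋆-algebra, isometries whose range projections sum to `1` have orthogonal ranges. -/
theorem star_mul_eq_zero_of_sum_mul_star_eq_one {A : Type*} [CStarAlgebra A]
    {ι : Type*} [Fintype ι] (S : ι → A) (hiso : ∀ i, star (S i) * S i = 1)
    (hsum : ∑ i, S i * star (S i) = 1) {i j : ι} (hij : i ≠ j) :
    star (S i) * S j = 0 := by
  classical
  letI := CStarAlgebra.spectralOrder A
  haveI := CStarAlgebra.spectralOrderedRing A
  have h1 : ∑ k, (star (S i) * S k) * star (star (S i) * S k) = 1 := by
    have h : star (S i) * (∑ k, S k * star (S k)) * S i = 1 := by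
      rw [hsum, mul_one, hiso]
    rw [← h, Finset.mul_sum, Finset.sum_mul]
    exact Finset.sum_congr rfl fun k _ => by simp [mul_assoc]
  rw [← Finset.add_sum_erase _ _ (Finset.mem_univ i), hiso, star_one, mul_one,
    add_eq_left] at h1
  have h2 := (Finset.sum_eq_zero_iff_of_nonneg fun k _ => mul_star_self_nonneg _).1 h1 j
    (Finset.mem_erase.2 ⟨hij.symm, Finset.mem_univ j⟩)
  exact (CStarRing.mul_star_self_eq_zero_iff _).1 h2

/-- A commutation relation with the image of a continuous star homomorphism may be checked on
topological generators and their adjoints. -/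
theorem commute_map_of_topologicalClosure_adjoin_eq_top {A B : Type*} [CStarAlgebra A]
    [CStarAlgebra B] {s : Set A} (hs : (StarAlgebra.adjoin ℂ s).topologicalClosure = ⊤)
    (f : A →⋆ₐ[ℂ] B) (hf : Continuous f) {x : B} (h : ∀ a ∈ s, Commute x (f a))
    (hstar : ∀ a ∈ s, Commute x (f (star a))) (a : A) : Commute x (f a) := by
  have hadj : ∀ b ∈ StarAlgebra.adjoin ℂ s, Commute x (f b) ∧ Commute x (f (star b)) := by
    intro b hb
    induction hb using StarAlgebra.adjoin_induction with
    | mem b hb => exact ⟨h b hb, hstar b hb⟩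
    | algebraMap r =>
      rw [← algebraMap_star_comm, AlgHomClass.commutes, AlgHomClass.commutes]
      exact ⟨(Algebra.commutes _ _).symm, (Algebra.commutes _ _).symm⟩
    | add b c _ _ hb hc =>
      rw [star_add, map_add, map_add]
      exact ⟨hb.1.add_right hc.1, hb.2.add_right hc.2⟩
    | mul b c _ _ hb hc =>
      rw [star_mul, map_mul, map_mul]
      exact ⟨hb.1.mul_right hc.1, hc.2.mul_right hb.2⟩
    | star b _ hb => exact ⟨hb.2, by rw [star_star]; exact hb.1⟩
  have hclosed : IsClosed {b : A | x * f b = f b * x} :=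
    isClosed_eq (continuous_const.mul hf) (hf.mul continuous_const)
  have ha : a ∈ (StarAlgebra.adjoin ℂ s).topologicalClosure := by
    rw [hs]; exact StarSubalgebra.mem_top
  rw [← SetLike.mem_coe, StarSubalgebra.topologicalClosure_coe] at ha
  exact closure_minimal (fun b hb => (hadj b hb).1.eq) hclosed ha

/-- for `x ∈ A`, `x` commutes with the range of `λ_u` iff
`x = u φ(x) u*`; i.e. `(λ_u,λ_u) = {x : x = (Ad u ∘ φ)(x)}`. -/
theorem stmt3 {A : Type*} [NormedRing A] [StarRing A] [CStarRing A]
    [CompleteSpace A] [NormedAlgebra ℂ A] [StarModule ℂ A]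
    {n : ℕ} (hn : 2 ≤ n) (S : Fin n → A)
    (hiso : ∀ i, star (S i) * S i = 1)
    (hcuntz : ∑ i, S i * star (S i) = 1)
    (hgen : (StarAlgebra.adjoin ℂ (Set.range S)).topologicalClosure = ⊤)
    (u : A) (hu : u ∈ unitary A)
    (lu : A →⋆ₐ[ℂ] A) (hlu : ∀ i, lu (S i) = u * S i)
    (x : A) :
    (∀ a : A, x * lu a = lu a * x) ↔ x = u * cuntzPhi S x * star u := by
  letI : CStarAlgebra A := {}
  have huu : star u * u = 1 := Unitary.star_mul_self_of_mem hu
  have huu' : u * star u = 1 := Unitary.mul_star_self_of_mem hu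
  constructor
  · intro h
    have hterm : ∀ i, u * (S i * x * star (S i)) = x * u * (S i * star (S i)) := fun i => by
      have := h (S i)
      rw [hlu] at this
      simp only [← mul_assoc] at this ⊢
      rw [this]
    rw [cuntzPhi, Finset.mul_sum, Finset.sum_congr rfl fun i _ => hterm i, ← Finset.mul_sum,
      hcuntz, mul_one, mul_assoc, huu', mul_one]
  · intro h
    have horth : ∀ i j, i ≠ j → star (S i) * S j = 0 := fun i j hij =>
      star_mul_eq_zero_of_sum_mul_star_eq_one S hiso hcuntz hij
    have hright : ∀ j, cuntzPhi S x * S j = S j * x := fun j => by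
      rw [cuntzPhi, Finset.sum_mul, Finset.sum_eq_single j]
      · rw [mul_assoc, hiso, mul_one]
      · intro i _ hij
        rw [mul_assoc, horth i j hij, mul_zero]
      · simp
    have hleft : ∀ j, star (S j) * cuntzPhi S x = x * star (S j) := fun j => by
      rw [cuntzPhi, Finset.mul_sum, Finset.sum_eq_single j]
      · rw [← mul_assoc, ← mul_assoc, hiso, one_mul]
      · intro i _ hij
        rw [← mul_assoc, ← mul_assoc, horth j i hij.symm, zero_mul, zero_mul]
      · simp
    have hxu : x * u = u * cuntzPhi S x := by
      conv_lhs => rw [h]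
      rw [mul_assoc, huu, mul_one]
    have hux : star u * x = cuntzPhi S x * star u := by
      conv_lhs => rw [h]
      rw [← mul_assoc, ← mul_assoc, huu, one_mul]
    have hcont : Continuous lu :=
      AddMonoidHomClass.continuous_of_bound lu 1 fun a => by
        rw [one_mul]
        exact NonUnitalStarAlgHom.norm_apply_le lu a
    refine fun a => (commute_map_of_topologicalClosure_adjoin_eq_top hgen lu hcont ?_ ?_ a).eq
    · rintro _ ⟨j, rfl⟩
      rw [hlu, commute_iff_eq, ← mul_assoc, hxu, mul_assoc, hright, mul_assoc]
    · rintro _ ⟨j, rfl⟩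
      rw [map_star, hlu, star_mul, commute_iff_eq, mul_assoc, hux, ← mul_assoc, ← mul_assoc,
        hleft]
end

section
/- Let Y ∈ F_n^2 be a unitary, let λ_Y : A → A be a unital *-homomorphism with λ_Y(Sᵢ) = YSᵢ for all i, and assume A is generated by S₁,…,Sₙ. Then Y satisfies the Yang–Baxter (braid) relation Yφ(Y)Y = φ(Y)Yφ(Y) if and only if Y commutes with λ_Y(λ_Y(a)) for every a ∈ A, i.e. Y ∈ λ_Y²(A)′ ∩ A. -/
section CuntzShift

variable {A : Type*} [Ring A] [StarRing A] {n : ℕ} {S : Fin n → A}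

/-- The intertwining relation `φ(x) Sᵢ = Sᵢ x`. -/
theorem cuntzPhi_mul_gen (horth : ∀ i j, i ≠ j → star (S i) * S j = 0)
    (hiso : ∀ i, star (S i) * S i = 1) (x : A) (i : Fin n) :
    cuntzPhi S x * S i = S i * x := by
  rw [cuntzPhi, Finset.sum_mul, Finset.sum_eq_single i]
  · rw [mul_assoc, hiso, mul_one]
  · intro j _ hj
    rw [mul_assoc, horth j i hj, mul_zero]
  · simp

theorem star_cuntzPhi (x : A) : star (cuntzPhi S x) = cuntzPhi S (star x) := by
  simp [cuntzPhi, star_sum, mul_assoc]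

theorem eq_of_forall_mul_gen_eq (hcuntz : ∑ i, S i * star (S i) = 1) {x y : A}
    (h : ∀ i, x * S i = y * S i) : x = y := by
  rw [← mul_one x, ← mul_one y, ← hcuntz, Finset.mul_sum, Finset.mul_sum]
  exact Finset.sum_congr rfl fun i _ => by rw [← mul_assoc, h, mul_assoc]

end CuntzShift

theorem cuntzWord_two {A : Type*} [Monoid A] {n : ℕ} {S : Fin n → A} (μ : Fin 2 → Fin n) :
    cuntzWord S μ = S (μ 0) * S (μ 1) := by
  simp [cuntzWord]

/-- Isometries in a C⋆-algebra whose range projections sum to `1` have orthogonal ranges. -/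
theorem star_gen_mul_gen_eq_zero {A : Type*} [CStarAlgebra A] {n : ℕ} {S : Fin n → A}
    (hiso : ∀ i, star (S i) * S i = 1) (hcuntz : ∑ i, S i * star (S i) = 1)
    (i j : Fin n) (hij : i ≠ j) : star (S i) * S j = 0 := by
  let := CStarAlgebra.spectralOrder A
  have := CStarAlgebra.spectralOrderedRing A
  have hsum : ∑ k, star (star (S k) * S j) * (star (S k) * S j) = 1 := by
    calc _ = star (S j) * (∑ k, S k * star (S k)) * S j := by
          simp [Finset.mul_sum, Finset.sum_mul, mul_assoc]
      _ = 1 := by rw [hcuntz, mul_one, hiso]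
  rw [← Finset.add_sum_erase _ _ (Finset.mem_univ j), hiso, star_one, mul_one,
    add_eq_left] at hsum
  have h := (Finset.sum_eq_zero_iff_of_nonneg
    fun k _ => star_mul_self_nonneg (star (S k) * S j)).1 hsum i
    (Finset.mem_erase.2 ⟨hij, Finset.mem_univ i⟩)
  exact CStarRing.star_mul_self_eq_zero_iff _ |>.1 h

/-- An endomorphism with `λ(Sᵢ) = u Sᵢ` acts on `F_n²` as conjugation by `u φ(u)`. -/
theorem map_eq_conj_of_mem_cuntzF_two {A : Type*} [Ring A] [StarRing A] [Algebra ℂ A]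
    {n : ℕ} {S : Fin n → A} (hφ : ∀ x i, cuntzPhi S x * S i = S i * x)
    {u : A} {l : A →⋆ₐ[ℂ] A} (hl : ∀ i, l (S i) = u * S i)
    {x : A} (hx : x ∈ cuntzF S 2) :
    l x = u * cuntzPhi S u * x * star (u * cuntzPhi S u) := by
  have hword (μ : Fin 2 → Fin n) :
      l (cuntzWord S μ) = u * cuntzPhi S u * cuntzWord S μ := by
    simp only [cuntzWord_two, map_mul, hl]
    rw [mul_assoc u (cuntzPhi S u), ← mul_assoc (cuntzPhi S u), hφ]
    simp only [mul_assoc]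
  induction hx using Submodule.span_induction with
  | mem x hx =>
    obtain ⟨μ, ν, rfl⟩ := hx
    rw [map_mul, map_star, hword, hword, star_mul (u * cuntzPhi S u)]
    simp only [mul_assoc]
  | zero => simp
  | add x y _ _ hx hy => rw [map_add, hx, hy, mul_add, add_mul]
  | smul c x _ hx => rw [map_smul, hx, mul_smul_comm, smul_mul_assoc]

/-- A unitary commuting with the images of topological generators under a continuous
⋆-homomorphism commutes with its whole range. -/
theorem commute_map_of_commute_map_generators {A B : Type*}
    [Ring A] [StarRing A] [Algebra ℂ A] [StarModule ℂ A] [TopologicalSpace A]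
    [IsTopologicalSemiring A] [ContinuousStar A]
    [Ring B] [StarRing B] [Algebra ℂ B] [TopologicalSpace B] [T2Space B] [ContinuousMul B]
    {s : Set A} (hs : (StarAlgebra.adjoin ℂ s).topologicalClosure = ⊤)
    {f : A →⋆ₐ[ℂ] B} (hf : Continuous f) {u : B} (hu : u ∈ unitary B)
    (h : ∀ a ∈ s, Commute u (f a)) (a : A) : Commute u (f a) := by
  have hclosed : IsClosed {a | Commute u (f a)} :=
    isClosed_eq (continuous_const.mul hf) (hf.mul continuous_const)
  have hmem : a ∈ closure (StarAlgebra.adjoin ℂ s : Set A) := by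
    rw [← StarSubalgebra.topologicalClosure_coe, hs]
    trivial
  refine closure_minimal (fun b hb => ?_) hclosed hmem
  induction hb using StarAlgebra.adjoin_induction with
  | mem x hx => exact h x hx
  | algebraMap r =>
    rw [Set.mem_ofPred_eq, AlgHomClass.commutes]
    exact (Algebra.commutes r u).symm
  | add x y _ _ hx hy => simpa using Commute.add_right hx hy
  | mul x y _ _ hx hy => simpa using Commute.mul_right hx hy
  | star x _ hx =>
    have hx' : Commute (star u) (f x) := by
      calc star u * f x = star u * (f x * u) * star u := by
            rw [mul_assoc, mul_assoc, Unitary.mul_star_self_of_mem hu, mul_one]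
        _ = f x * star u := by
            rw [← (show u * f x = f x * u from hx), ← mul_assoc (star u),
              Unitary.star_mul_self_of_mem hu, one_mul]
    simpa [map_star] using hx'.star_star

/-- a unitary `Y ∈ F_n²` satisfies the Yang–Baxter relation
`Yφ(Y)Y = φ(Y)Yφ(Y)` iff `Y` commutes with the range of `λ_Y²`. -/
theorem stmt4 {A : Type*} [NormedRing A] [StarRing A] [CStarRing A]
    [CompleteSpace A] [NormedAlgebra ℂ A] [StarModule ℂ A]
    {n : ℕ} (hn : 2 ≤ n) (S : Fin n → A)
    (hiso : ∀ i, star (S i) * S i = 1)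
    (hcuntz : ∑ i, S i * star (S i) = 1)
    (hgen : (StarAlgebra.adjoin ℂ (Set.range S)).topologicalClosure = ⊤)
    (Y : A) (hYF : Y ∈ cuntzF S 2) (hY : Y ∈ unitary A)
    (lY : A →⋆ₐ[ℂ] A) (hlY : ∀ i, lY (S i) = Y * S i) :
    (Y * cuntzPhi S Y * Y = cuntzPhi S Y * Y * cuntzPhi S Y) ↔
      ∀ a : A, Y * lY (lY a) = lY (lY a) * Y := by
  let : CStarAlgebra A := {}
  have horth := star_gen_mul_gen_eq_zero hiso hcuntz
  have hφ := cuntzPhi_mul_gen horth hiso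
  have hYs : star Y * Y = 1 := Unitary.star_mul_self_of_mem hY
  have hsY : Y * star Y = 1 := Unitary.mul_star_self_of_mem hY
  have hsq (i : Fin n) : lY (lY (S i)) = Y * cuntzPhi S Y * Y * S i * star Y := by
    rw [hlY, map_mul, hlY, map_eq_conj_of_mem_cuntzF_two hφ hlY hYF, star_mul, star_cuntzPhi]
    simp only [mul_assoc]
    rw [← mul_assoc (star Y) Y, hYs, one_mul, hφ]
  have hcont : Continuous (lY.comp lY) :=
    AddMonoidHomClass.continuous_of_bound (lY.comp lY) 1 fun a => by
      simpa using NonUnitalStarAlgHom.norm_apply_le (lY.comp lY) a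
  have hgens (i : Fin n) : Commute Y (lY (lY (S i))) ↔
      Y * cuntzPhi S Y * Y * S i = cuntzPhi S Y * Y * cuntzPhi S Y * S i := by
    rw [commute_iff_eq, hsq]
    have hl : Y * (Y * cuntzPhi S Y * Y * S i * star Y) =
        Y * (Y * cuntzPhi S Y * Y * S i) * star Y := by simp only [mul_assoc]
    have hr : Y * cuntzPhi S Y * Y * S i * star Y * Y =
        Y * (cuntzPhi S Y * Y * cuntzPhi S Y * S i) * star Y := by
      rw [mul_assoc (cuntzPhi S Y * Y), hφ]
      simp only [mul_assoc, hYs, hsY]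
    rw [hl, hr]
    refine ⟨fun h => ?_, fun h => by rw [h]⟩
    have h' := congrArg (fun x => star Y * (x * Y)) h
    simpa only [mul_assoc _ (star Y) Y, hYs, mul_one, ← mul_assoc (star Y) Y, one_mul] using h'
  constructor
  · intro h a
    refine commute_map_of_commute_map_generators hgen hcont hY ?_ a
    rintro _ ⟨i, rfl⟩
    exact (hgens i).2 (by rw [h])
  · intro h
    exact eq_of_forall_mul_gen_eq hcuntz fun i => (hgens i).1 (h (S i))
end

section
/- Let Y ∈ F_n^2 be a unitary satisfying the Yang–Baxter (braid) relation Yφ(Y)Y = φ(Y)Yφ(Y), and suppose Y is not a scalar multiple of the identity. Let λ_Y : A → A be a unital *-homomorphism with λ_Y(Sᵢ) = YSᵢ for all i, assume A is generated by S₁,…,Sₙ, and assume the center of A consists of scalar multiples of the identity. Then λ_Y ∘ λ_Y is not surjective, and in particular λ_Y is not an automorphism of A. -/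
section CuntzHelpers

variable {A : Type*} [CStarAlgebra A] {n : ℕ} {S : Fin n → A}

/-- Isometries satisfying the Cuntz relation have mutually orthogonal ranges. -/
theorem cuntz_star_mul_of_ne (hiso : ∀ i, star (S i) * S i = 1)
    (hcuntz : ∑ i, S i * star (S i) = 1) {i j : Fin n} (hij : i ≠ j) :
    star (S i) * S j = 0 := by
  let _ : PartialOrder A := CStarAlgebra.spectralOrder A
  have _ : StarOrderedRing A := CStarAlgebra.spectralOrderedRing A
  have hsum : ∑ k, star (star (S k) * S j) * (star (S k) * S j) = 1 := by
    calc ∑ k, star (star (S k) * S j) * (star (S k) * S j)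
        = star (S j) * (∑ k, S k * star (S k)) * S j := by
          rw [Finset.mul_sum, Finset.sum_mul]
          simp only [star_mul, star_star, mul_assoc]
      _ = 1 := by rw [hcuntz, mul_one, hiso]
  rw [← Finset.add_sum_erase _ _ (Finset.mem_univ j), hiso, star_one, mul_one,
    add_eq_left, Finset.sum_eq_zero_iff_of_nonneg fun k _ => star_mul_self_nonneg _] at hsum
  exact CStarRing.star_mul_self_eq_zero_iff _ |>.mp
    (hsum i (Finset.mem_erase.mpr ⟨hij, Finset.mem_univ i⟩))

theorem cuntzPhi_mul_generator (hiso : ∀ i, star (S i) * S i = 1)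
    (hcuntz : ∑ i, S i * star (S i) = 1) (x : A) (j : Fin n) :
    cuntzPhi S x * S j = S j * x := by
  rw [cuntzPhi, Finset.sum_mul, Finset.sum_eq_single j]
  · rw [mul_assoc, hiso, mul_one]
  · intro i _ hij
    rw [mul_assoc, cuntz_star_mul_of_ne hiso hcuntz hij, mul_zero]
  · simp

theorem cuntzPhi_mul_star_self (hiso : ∀ i, star (S i) * S i = 1)
    (hcuntz : ∑ i, S i * star (S i) = 1) {u : A} (hu : u * star u = 1) :
    cuntzPhi S u * star (cuntzPhi S u) = 1 := by
  nth_rewrite 1 [cuntzPhi]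
  rw [Finset.sum_mul, ← hcuntz]
  refine Finset.sum_congr rfl fun i _ => ?_
  have h := congrArg star (cuntzPhi_mul_generator hiso hcuntz u i)
  rw [star_mul, star_mul] at h
  rw [mul_assoc, h, mul_assoc, ← mul_assoc u, hu, one_mul]

/-- On `F_n²` the endomorphism `λ_u` is implemented by `u φ(u)`. -/
theorem cuntzEndomorphism_apply_of_mem_cuntzF_two (hiso : ∀ i, star (S i) * S i = 1)
    (hcuntz : ∑ i, S i * star (S i) = 1) {u : A} (l : A →⋆ₐ[ℂ] A)
    (hl : ∀ i, l (S i) = u * S i) {x : A} (hx : x ∈ cuntzF S 2) :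
    l x = u * cuntzPhi S u * x * star (u * cuntzPhi S u) := by
  induction hx using Submodule.span_induction with
  | mem x hx =>
    obtain ⟨μ, ν, rfl⟩ := hx
    have hword (μ : Fin 2 → Fin n) :
        l (cuntzWord S μ) = u * cuntzPhi S u * cuntzWord S μ := by
      have h := cuntzPhi_mul_generator hiso hcuntz u (μ 0)
      simp only [cuntzWord, List.ofFn_succ, List.ofFn_zero, List.prod_cons, List.prod_nil,
        mul_one, map_mul, hl, Fin.succ_zero_eq_one]
      calc u * S (μ 0) * (u * S (μ 1)) = u * (S (μ 0) * u) * S (μ 1) := by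
            simp only [mul_assoc]
        _ = _ := by rw [← h]; simp only [mul_assoc]
    rw [map_mul, map_star, hword, hword]
    simp only [star_mul, mul_assoc]
  | zero => simp
  | add x y _ _ hx hy => rw [map_add, hx, hy, mul_add, add_mul]
  | smul c x _ hx => rw [map_smul, hx, mul_smul_comm, smul_mul_assoc]

/-- A Yang–Baxter unitary `Y` satisfies `λ_Y(Y) = φ(Y)`. -/
theorem cuntzEndomorphism_apply_yangBaxter (hiso : ∀ i, star (S i) * S i = 1)
    (hcuntz : ∑ i, S i * star (S i) = 1) {Y : A} (hYF : Y ∈ cuntzF S 2) (hY : Y ∈ unitary A)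
    (hYBE : Y * cuntzPhi S Y * Y = cuntzPhi S Y * Y * cuntzPhi S Y)
    (l : A →⋆ₐ[ℂ] A) (hl : ∀ i, l (S i) = Y * S i) : l Y = cuntzPhi S Y := by
  have hYY := Unitary.mul_star_self_of_mem hY
  rw [cuntzEndomorphism_apply_of_mem_cuntzF_two hiso hcuntz l hl hYF, hYBE, star_mul,
    mul_assoc, ← mul_assoc (cuntzPhi S Y) (star _),
    cuntzPhi_mul_star_self hiso hcuntz hYY, one_mul, mul_assoc, hYY, mul_one]

/-- A unitary commuting with the images of generators of a C*-algebra under a *-homomorphism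
commutes with its range. -/
theorem StarAlgHom.commute_unitary_of_adjoin_dense {s : Set A}
    (hs : (StarAlgebra.adjoin ℂ s).topologicalClosure = ⊤) (f : A →⋆ₐ[ℂ] A) {u : A}
    (hu : u ∈ unitary A) (h : ∀ x ∈ s, u * f x = f x * u) (a : A) : u * f a = f a * u := by
  have hf : Continuous f :=
    AddMonoidHomClass.continuous_of_bound f 1 fun x => by
      simpa only [one_mul] using NonUnitalStarAlgHom.norm_apply_le f x
  let C : StarSubalgebra ℂ A := (StarSubalgebra.centralizer ℂ {u}).comap f
  have mem_C (x : A) : x ∈ C ↔ u * f x = f x * u := by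
    simp only [C, StarSubalgebra.mem_comap, StarSubalgebra.mem_centralizer_iff,
      Set.mem_singleton_iff, forall_eq]
    refine ⟨And.left, fun hx => ⟨hx, ?_⟩⟩
    calc star u * f x = star u * (f x * u) * star u := by
          rw [mul_assoc, mul_assoc, Unitary.mul_star_self_of_mem hu, mul_one]
      _ = f x * star u := by
          rw [← hx, ← mul_assoc, Unitary.star_mul_self_of_mem hu, one_mul]
  have hclosed : IsClosed (C : Set A) := by
    have : (C : Set A) = {x | u * f x = f x * u} := Set.ext mem_C
    rw [this]
    exact isClosed_eq (by fun_prop) (by fun_prop)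
  have hle := StarSubalgebra.topologicalClosure_minimal
    (StarAlgebra.adjoin_le fun x hx => (mem_C x).mpr (h x hx)) hclosed
  rw [hs] at hle
  exact (mem_C a).mp (hle trivial)

end CuntzHelpers

/-- if a non-scalar unitary `Y ∈ F_n²` satisfies the Yang–Baxter
relation, then `λ_Y ∘ λ_Y` is not surjective, and in particular `λ_Y` is not
an automorphism of `A`. -/
theorem stmt5 {A : Type*} [NormedRing A] [StarRing A] [CStarRing A]
    [CompleteSpace A] [NormedAlgebra ℂ A] [StarModule ℂ A]
    {n : ℕ} (hn : 2 ≤ n) (S : Fin n → A)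
    (hiso : ∀ i, star (S i) * S i = 1)
    (hcuntz : ∑ i, S i * star (S i) = 1)
    (hgen : (StarAlgebra.adjoin ℂ (Set.range S)).topologicalClosure = ⊤)
    (hcenter : ∀ x : A, (∀ a : A, x * a = a * x) → ∃ c : ℂ, x = c • (1 : A))
    (Y : A) (hYF : Y ∈ cuntzF S 2) (hY : Y ∈ unitary A)
    (hYBE : Y * cuntzPhi S Y * Y = cuntzPhi S Y * Y * cuntzPhi S Y)
    (hYns : ∀ c : ℂ, Y ≠ c • (1 : A))
    (lY : A →⋆ₐ[ℂ] A) (hlY : ∀ i, lY (S i) = Y * S i) :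
    ¬ Function.Surjective (fun a : A => lY (lY a)) ∧ ¬ Function.Bijective (lY : A → A) := by
  let _ : CStarAlgebra A := {}
  have hlYY := cuntzEndomorphism_apply_yangBaxter hiso hcuntz hYF hY hYBE lY hlY
  have hcomm := StarAlgHom.commute_unitary_of_adjoin_dense hgen (lY.comp lY) hY (by
    rintro _ ⟨i, rfl⟩
    rw [StarAlgHom.comp_apply, hlY, map_mul, hlYY, hlY, ← mul_assoc, ← mul_assoc, hYBE]
    simp only [mul_assoc, cuntzPhi_mul_generator hiso hcuntz])
  have hsurj : ¬ Function.Surjective (fun a : A => lY (lY a)) := by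
    intro h
    obtain ⟨c, hc⟩ := hcenter Y fun a => by
      obtain ⟨b, rfl⟩ := h a
      exact hcomm b
    exact hYns c hc
  exact ⟨hsurj, fun h => hsurj (h.surjective.comp h.surjective)⟩
end

section
/- Let r ≥ 1 and let u ∈ F_n^r be a unitary satisfying the polynomial matrix equation v_r u v_r* = u_r* u u_r, where v := u_r* u* u_r and v_r := vφ(v)φ²(v)⋯φ^{r-1}(v). Let λ_u and λ_v be unital *-homomorphisms A → A with λ_u(Sᵢ) = uSᵢ and λ_v(Sᵢ) = vSᵢ for all i, and assume A is generated by S₁,…,Sₙ. Then λ_u ∘ λ_v = id_A = λ_v ∘ λ_u; in particular λ_u is an automorphism of A with inverse induced by v = u_r* u* u_r. -/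
namespace CuntzSetup

/-- Isometries whose range projections sum to `1` have mutually orthogonal ranges. -/
theorem star_mul_eq_ite {A : Type*} [CStarAlgebra A] {n : ℕ} {S : Fin n → A}
    (hiso : ∀ i, star (S i) * S i = 1) (hcuntz : ∑ i, S i * star (S i) = 1) (i j : Fin n) :
    star (S i) * S j = if i = j then 1 else 0 := by
  let := CStarAlgebra.spectralOrder A
  have := CStarAlgebra.spectralOrderedRing A
  split_ifs with hij
  · rw [hij, hiso]
  have hsum : ∑ k, star (star (S k) * S j) * (star (S k) * S j) = 1 := by
    have : star (S j) * (∑ k, S k * star (S k)) * S j = 1 := by rw [hcuntz, mul_one, hiso]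
    simpa [Finset.mul_sum, Finset.sum_mul, mul_assoc] using this
  rw [← Finset.add_sum_erase _ _ (Finset.mem_univ j), hiso, star_one, mul_one,
    add_eq_left, Finset.sum_eq_zero_iff_of_nonneg fun k _ => star_mul_self_nonneg _] at hsum
  exact CStarRing.star_mul_self_eq_zero_iff _ |>.1 (hsum i (by simp [hij]))

section Shift

variable {A : Type*} [Ring A] [StarRing A] {n : ℕ} {S : Fin n → A}

theorem cuntzPhi_star (S : Fin n → A) (x : A) : cuntzPhi S (star x) = star (cuntzPhi S x) := by
  simp [cuntzPhi, mul_assoc]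

theorem cuntzPhi_mul_gen (horth : ∀ i j, star (S i) * S j = if i = j then 1 else 0)
    (x : A) (j : Fin n) : cuntzPhi S x * S j = S j * x := by
  simp [cuntzPhi, Finset.sum_mul, mul_assoc, horth]

theorem cuntzPhi_mul (horth : ∀ i j, star (S i) * S j = if i = j then 1 else 0) (x y : A) :
    cuntzPhi S (x * y) = cuntzPhi S x * cuntzPhi S y := by
  rw [cuntzPhi, cuntzPhi.eq_def S y, Finset.mul_sum]
  refine Finset.sum_congr rfl fun i _ => ?_
  simp only [← mul_assoc, cuntzPhi_mul_gen horth]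

theorem cuntzPhi_one (hcuntz : ∑ i, S i * star (S i) = 1) : cuntzPhi S 1 = 1 := by
  simpa [cuntzPhi] using hcuntz

theorem cuntzPhi_list_prod (horth : ∀ i j, star (S i) * S j = if i = j then 1 else 0)
    (hcuntz : ∑ i, S i * star (S i) = 1) (l : List A) :
    cuntzPhi S l.prod = (l.map (cuntzPhi S)).prod := by
  induction l with
  | nil => simpa using cuntzPhi_one hcuntz
  | cons a l ih => simp [cuntzPhi_mul horth, ih]

theorem cuntzPhi_mem_unitary (horth : ∀ i j, star (S i) * S j = if i = j then 1 else 0)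
    (hcuntz : ∑ i, S i * star (S i) = 1) {u : A} (hu : u ∈ unitary A) :
    cuntzPhi S u ∈ unitary A := by
  rw [Unitary.mem_iff] at hu ⊢
  simp only [← cuntzPhi_star, ← cuntzPhi_mul horth, hu, cuntzPhi_one hcuntz, and_self]

theorem cuntzUk_zero (S : Fin n → A) (u : A) : cuntzUk S u 0 = 1 := by
  simp [cuntzUk]

theorem cuntzUk_succ (horth : ∀ i j, star (S i) * S j = if i = j then 1 else 0)
    (hcuntz : ∑ i, S i * star (S i) = 1) (u : A) (k : ℕ) :
    cuntzUk S u (k + 1) = u * cuntzPhi S (cuntzUk S u k) := by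
  simp only [cuntzUk, cuntzPhi_list_prod horth hcuntz, List.range_succ_eq_map, List.map_cons,
    List.map_map, List.prod_cons, Function.iterate_zero, id]
  congr 3
  funext j
  simp [Function.iterate_succ_apply']

theorem cuntzUk_mem_unitary (horth : ∀ i j, star (S i) * S j = if i = j then 1 else 0)
    (hcuntz : ∑ i, S i * star (S i) = 1) {u : A} (hu : u ∈ unitary A) (k : ℕ) :
    cuntzUk S u k ∈ unitary A := by
  induction k with
  | zero => rw [cuntzUk_zero]; exact one_mem _
  | succ k ih =>
    rw [cuntzUk_succ horth hcuntz]
    exact mul_mem hu (cuntzPhi_mem_unitary horth hcuntz ih)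

end Shift

section MatrixCore

variable {A : Type*} [Ring A] [StarRing A] [Algebra ℂ A] {n : ℕ} {S : Fin n → A}

/-- The elements all of whose iterated matrix entries `S_μ* x S_ν`, with `μ` and `ν` of length
`k`, are scalars. -/
def matrixCore (S : Fin n → A) : ℕ → Submodule ℂ A
  | 0 => 1
  | k + 1 => ⨅ i, ⨅ j, (matrixCore S k).comap (LinearMap.mulLeftRight ℂ (star (S i), S j))

theorem mem_matrixCore_succ {k : ℕ} {x : A} :
    x ∈ matrixCore S (k + 1) ↔ ∀ i j, star (S i) * x * S j ∈ matrixCore S k := by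
  simp [matrixCore]

theorem one_mem_matrixCore (horth : ∀ i j, star (S i) * S j = if i = j then 1 else 0) (k : ℕ) :
    (1 : A) ∈ matrixCore S k := by
  induction k with
  | zero => exact Submodule.mem_one.2 ⟨1, map_one _⟩
  | succ k ih =>
    refine mem_matrixCore_succ.2 fun i j => ?_
    rw [mul_one, horth]
    split_ifs
    exacts [ih, zero_mem _]

theorem matrixCore_mono (horth : ∀ i j, star (S i) * S j = if i = j then 1 else 0) :
    Monotone (matrixCore S) := by
  refine monotone_nat_of_le_succ fun k => ?_
  induction k with
  | zero =>
    exact Submodule.one_le.2 (one_mem_matrixCore horth 1)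
  | succ k ih =>
    exact fun x hx => mem_matrixCore_succ.2 fun i j => ih (mem_matrixCore_succ.1 hx i j)

theorem mul_mem_matrixCore (hcuntz : ∑ i, S i * star (S i) = 1) {k : ℕ} {x y : A}
    (hx : x ∈ matrixCore S k) (hy : y ∈ matrixCore S k) : x * y ∈ matrixCore S k := by
  induction k generalizing x y with
  | zero =>
    obtain ⟨c, rfl⟩ := Submodule.mem_one.1 hx
    obtain ⟨d, rfl⟩ := Submodule.mem_one.1 hy
    exact Submodule.mem_one.2 ⟨c * d, map_mul _ _ _⟩
  | succ k ih =>
    rw [mem_matrixCore_succ] at *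
    intro i j
    have : star (S i) * (x * y) * S j =
        ∑ l, (star (S i) * x * S l) * (star (S l) * y * S j) := by
      conv_lhs => rw [← mul_one x, ← hcuntz]
      simp [Finset.mul_sum, Finset.sum_mul, mul_assoc]
    rw [this]
    exact sum_mem fun l _ => ih (hx i l) (hy l j)

theorem star_mem_matrixCore [StarModule ℂ A] {k : ℕ} {x : A} (hx : x ∈ matrixCore S k) :
    star x ∈ matrixCore S k := by
  induction k generalizing x with
  | zero =>
    obtain ⟨c, rfl⟩ := Submodule.mem_one.1 hx
    exact Submodule.mem_one.2 ⟨star c, algebraMap_star_comm c⟩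
  | succ k ih =>
    rw [mem_matrixCore_succ] at *
    intro i j
    simpa [mul_assoc] using ih (hx j i)

theorem cuntzPhi_mem_matrixCore (horth : ∀ i j, star (S i) * S j = if i = j then 1 else 0)
    {k : ℕ} {x : A} (hx : x ∈ matrixCore S k) : cuntzPhi S x ∈ matrixCore S (k + 1) := by
  refine mem_matrixCore_succ.2 fun i j => ?_
  rw [mul_assoc, cuntzPhi_mul_gen horth, ← mul_assoc, horth]
  split_ifs
  · simpa using hx
  · simp

theorem cuntzUk_mem_matrixCore (horth : ∀ i j, star (S i) * S j = if i = j then 1 else 0)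
    (hcuntz : ∑ i, S i * star (S i) = 1) {r : ℕ} {u : A} (hu : u ∈ matrixCore S r) (k : ℕ) :
    cuntzUk S u k ∈ matrixCore S (r + k) := by
  induction k with
  | zero => rw [cuntzUk_zero]; exact one_mem_matrixCore horth _
  | succ k ih =>
    rw [cuntzUk_succ horth hcuntz]
    exact mul_mem_matrixCore hcuntz (matrixCore_mono horth (Nat.le_add_right r (k + 1)) hu)
      (cuntzPhi_mem_matrixCore horth ih)

theorem cuntzF_le_matrixCore (horth : ∀ i j, star (S i) * S j = if i = j then 1 else 0) (k : ℕ) :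
    cuntzF S k ≤ matrixCore S k := by
  refine Submodule.span_le.2 ?_
  rintro _ ⟨μ, ν, rfl⟩
  induction k with
  | zero => simpa [cuntzWord] using one_mem_matrixCore horth 0
  | succ k ih =>
    refine mem_matrixCore_succ.2 fun i j => ?_
    have hword : ∀ (i : Fin n) (μ : Fin (k + 1) → Fin n), star (S i) * cuntzWord S μ =
        if i = μ 0 then cuntzWord S (fun l => μ l.succ) else 0 := fun i μ => by
      simp [cuntzWord, List.ofFn_succ, ← mul_assoc, horth]
    have hprod : star (S i) * (cuntzWord S μ * star (cuntzWord S ν)) * S j =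
        (star (S i) * cuntzWord S μ) * star (star (S j) * cuntzWord S ν) := by
      simp [mul_assoc]
    rw [hprod, hword, hword]
    split_ifs
    · exact ih _ _
    all_goals simp

/-- On the matrix core, an endomorphism `Sᵢ ↦ u Sᵢ` acts as conjugation by `u_k`. -/
theorem map_eq_conj_of_mem_matrixCore
    (horth : ∀ i j, star (S i) * S j = if i = j then 1 else 0)
    (hcuntz : ∑ i, S i * star (S i) = 1) {u : A}
    {f : A →⋆ₐ[ℂ] A} (hf : ∀ i, f (S i) = u * S i) {k : ℕ} {x : A} (hx : x ∈ matrixCore S k) :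
    f x = cuntzUk S u k * x * star (cuntzUk S u k) := by
  induction k generalizing x with
  | zero =>
    obtain ⟨c, rfl⟩ := Submodule.mem_one.1 hx
    simp [cuntzUk_zero, AlgHomClass.commutes]
  | succ k ih =>
    have hdecomp : x = ∑ i, ∑ j, S i * (star (S i) * x * S j) * star (S j) := by
      conv_lhs => rw [← mul_one x, ← one_mul x, ← hcuntz]
      simp only [Finset.mul_sum, Finset.sum_mul, mul_assoc]
      exact Finset.sum_comm
    have hentry : ∀ i j, f (S i * (star (S i) * x * S j) * star (S j)) =
        u * (S i * cuntzUk S u k * star (S i)) * x *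
          (S j * star (cuntzUk S u k) * star (S j)) * star u := fun i j => by
      rw [map_mul, map_mul, map_star, hf, hf, ih (mem_matrixCore_succ.1 hx i j)]
      simp only [star_mul, mul_assoc]
    rw [cuntzUk_succ horth hcuntz, star_mul, ← cuntzPhi_star]
    conv_lhs => rw [hdecomp]
    simp only [map_sum, hentry]
    simp only [cuntzPhi, Finset.mul_sum, Finset.sum_mul, ← mul_assoc]
    exact Finset.sum_comm

/-- An endomorphism `Sᵢ ↦ v Sᵢ` with `v` unitary sends only `1` to `1` on the matrix core. -/
theorem eq_one_of_map_eq_one (horth : ∀ i j, star (S i) * S j = if i = j then 1 else 0)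
    (hcuntz : ∑ i, S i * star (S i) = 1) {v : A} (hv : v ∈ unitary A)
    {f : A →⋆ₐ[ℂ] A} (hf : ∀ i, f (S i) = v * S i) {k : ℕ} {x : A} (hx : x ∈ matrixCore S k)
    (hfx : f x = 1) : x = 1 := by
  have hw := cuntzUk_mem_unitary horth hcuntz hv k
  rw [map_eq_conj_of_mem_matrixCore horth hcuntz hf hx] at hfx
  calc x = star (cuntzUk S v k) * (cuntzUk S v k * x * star (cuntzUk S v k)) * cuntzUk S v k := by
        simp only [mul_assoc, Unitary.star_mul_self_of_mem hw, mul_one]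
        rw [← mul_assoc, Unitary.star_mul_self_of_mem hw, one_mul]
    _ = 1 := by rw [hfx, mul_one, Unitary.star_mul_self_of_mem hw]

end MatrixCore

open scoped CStarAlgebra in
/-- If the composition of two unital star endomorphisms fixes a generating set, then it is the
identity. -/
theorem comp_apply_eq_self {A : Type*} [CStarAlgebra A] {s : Set A}
    (hgen : (StarAlgebra.adjoin ℂ s).topologicalClosure = ⊤) (f g : A →⋆ₐ[ℂ] A)
    (hs : ∀ x ∈ s, f (g x) = x) (a : A) : f (g a) = a := by
  have hle : (StarAlgebra.adjoin ℂ s).topologicalClosure ≤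
      StarAlgHom.equalizer (f.comp g) (StarAlgHom.id ℂ A) := by
    refine StarSubalgebra.topologicalClosure_minimal
      (StarAlgebra.adjoin_le fun x hx => hs x hx) ?_
    exact isClosed_eq ((map_continuous f).comp (map_continuous g)) continuous_id
  have : a ∈ (StarAlgebra.adjoin ℂ s).topologicalClosure := hgen ▸ StarSubalgebra.mem_top
  exact hle this

end CuntzSetup

/-- if a unitary `u ∈ F_n^r` satisfies the polynomial matrix
equation `v_r u v_r* = u_r* u u_r` with `v := u_r* u* u_r`, then
`λ_u ∘ λ_v = id = λ_v ∘ λ_u`; in particular `λ_u` is an automorphism with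
inverse induced by `v`. -/
theorem stmt9 {A : Type*} [NormedRing A] [StarRing A] [CStarRing A]
    [CompleteSpace A] [NormedAlgebra ℂ A] [StarModule ℂ A]
    {n : ℕ} (hn : 2 ≤ n) (S : Fin n → A)
    (hiso : ∀ i, star (S i) * S i = 1)
    (hcuntz : ∑ i, S i * star (S i) = 1)
    (hgen : (StarAlgebra.adjoin ℂ (Set.range S)).topologicalClosure = ⊤)
    (r : ℕ) (hr : 1 ≤ r)
    (u : A) (huF : u ∈ cuntzF S r) (hu : u ∈ unitary A)
    (heq : cuntzUk S (star (cuntzUk S u r) * star u * cuntzUk S u r) r * u *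
        star (cuntzUk S (star (cuntzUk S u r) * star u * cuntzUk S u r) r) =
      star (cuntzUk S u r) * u * cuntzUk S u r)
    (lu lv : A →⋆ₐ[ℂ] A)
    (hlu : ∀ i, lu (S i) = u * S i)
    (hlv : ∀ i, lv (S i) = (star (cuntzUk S u r) * star u * cuntzUk S u r) * S i) :
    (∀ a : A, lu (lv a) = a) ∧ (∀ a : A, lv (lu a) = a) ∧
      Function.Bijective (lu : A → A) := by
  let : CStarAlgebra A := {}
  have horth := CuntzSetup.star_mul_eq_ite hiso hcuntz
  have hw := CuntzSetup.cuntzUk_mem_unitary horth hcuntz hu r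
  have huG := CuntzSetup.cuntzF_le_matrixCore horth r huF
  have hwG := CuntzSetup.cuntzUk_mem_matrixCore horth hcuntz huG r
  set w := cuntzUk S u r
  have hv : star w * star u * w ∈ unitary A :=
    mul_mem (mul_mem (Unitary.star_mem hw) (Unitary.star_mem hu)) hw
  have hvG : star w * star u * w ∈ CuntzSetup.matrixCore S (r + r) :=
    CuntzSetup.mul_mem_matrixCore hcuntz
      (CuntzSetup.mul_mem_matrixCore hcuntz (CuntzSetup.star_mem_matrixCore hwG)
        (CuntzSetup.star_mem_matrixCore
          (CuntzSetup.matrixCore_mono horth (Nat.le_add_right r r) huG))) hwG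
  have hvstar : star (star w * star u * w) = star w * u * w := by simp [mul_assoc]
  set v := star w * star u * w
  have hlvu : lv u = star v := by
    rw [CuntzSetup.map_eq_conj_of_mem_matrixCore horth hcuntz hlv huG, heq, hvstar]
  have hleft : ∀ a, lv (lu a) = a := by
    refine CuntzSetup.comp_apply_eq_self hgen lv lu ?_
    rintro _ ⟨i, rfl⟩
    rw [hlu, map_mul, hlv, ← mul_assoc, hlvu, Unitary.star_mul_self_of_mem hv, one_mul]
  have hluvG : lu v ∈ CuntzSetup.matrixCore S (r + (r + r)) := by
    have hzG := CuntzSetup.cuntzUk_mem_matrixCore horth hcuntz huG (r + r)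
    rw [CuntzSetup.map_eq_conj_of_mem_matrixCore horth hcuntz hlu hvG]
    exact CuntzSetup.mul_mem_matrixCore hcuntz (CuntzSetup.mul_mem_matrixCore hcuntz hzG
      (CuntzSetup.matrixCore_mono horth (Nat.le_add_left _ r) hvG))
      (CuntzSetup.star_mem_matrixCore hzG)
  have hluv : lu v * u = 1 := by
    refine CuntzSetup.eq_one_of_map_eq_one horth hcuntz hv hlv
      (CuntzSetup.mul_mem_matrixCore hcuntz hluvG
        (CuntzSetup.matrixCore_mono horth (Nat.le_add_right r _) huG)) ?_
    rw [map_mul, hleft, hlvu, Unitary.mul_star_self_of_mem hv]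
  have hright : ∀ a, lu (lv a) = a := by
    refine CuntzSetup.comp_apply_eq_self hgen lu lv ?_
    rintro _ ⟨i, rfl⟩
    rw [hlv, map_mul, hlu, ← mul_assoc, hluv, one_mul]
  exact ⟨hright, hleft, Function.bijective_iff_has_inverse.2 ⟨lv, hleft, hright⟩⟩
end
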